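/- arXiv:1608.05631 — 3 statements merged into one kernel-verified Lean document; each statement's English description precedes it below -/
import Mathlib

section
/- For every n ∈ S, every element (λ, λ′, λ″, λ‴) of the 4-correlation set S₄(n) := {(λ,λ′,λ″,λ‴) ∈ Λ_n⁴ : λ − λ′ + λ″ − λ‴ = 0} has exactly one of the following four mutually exclusive structures: (a) λ = λ′ and λ″ = λ‴; (b) λ = −λ′ = −λ″ = λ‴; (c) λ ∉ {λ′, −λ′}, λ = −λ″ and λ′ = −λ‴; (d) λ ∉ {λ′, −λ′}, λ = λ‴ and λ′ = λ″. Consequently, |S₄(n)| = 3𝒩_n(𝒩_n − 1). -/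
noncomputable section

/-- The set of lattice points `λ ∈ ℤ²` with `‖λ‖² = n`. -/
def Lam (n : ℕ) : Finset (ℤ × ℤ) :=
  (Finset.Icc (-(n : ℤ), -(n : ℤ)) ((n : ℤ), (n : ℤ))).filter
    fun l => l.1 ^ 2 + l.2 ^ 2 = (n : ℤ)

/-- `𝒩_n`, the number of lattice points on the circle of radius `√n`. -/
def Nn (n : ℕ) : ℕ := (Lam n).card

/-- `n ∈ S`: `n ≥ 1` is a sum of two integer squares. -/
def inS (n : ℕ) : Prop := 1 ≤ n ∧ ∃ a b : ℤ, a ^ 2 + b ^ 2 = (n : ℤ)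

/-- The 4-correlation set `S₄(n) = {(λ,λ′,λ″,λ‴) ∈ Λ_n⁴ : λ − λ′ + λ″ − λ‴ = 0}`. -/
def S4 (n : ℕ) : Finset ((ℤ × ℤ) × (ℤ × ℤ) × (ℤ × ℤ) × (ℤ × ℤ)) :=
  ((Lam n) ×ˢ (Lam n) ×ˢ (Lam n) ×ˢ (Lam n)).filter
    fun q => q.1 - q.2.1 + q.2.2.1 - q.2.2.2 = 0

theorem mem_Lam {n : ℕ} {p : ℤ × ℤ} : p ∈ Lam n ↔ p.1 ^ 2 + p.2 ^ 2 = (n : ℤ) := by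
  simp only [Lam, Finset.mem_filter, Finset.mem_Icc, Prod.le_def, and_iff_right_iff_imp]
  intro h
  refine ⟨⟨?_, ?_⟩, ⟨?_, ?_⟩⟩ <;> nlinarith [sq_nonneg p.1, sq_nonneg p.2]

theorem neg_mem_Lam {n : ℕ} {p : ℤ × ℤ} (hp : p ∈ Lam n) : -p ∈ Lam n := by
  rw [mem_Lam] at *
  simpa using hp

theorem ne_neg_of_mem_Lam {n : ℕ} (hn : 1 ≤ n) {p : ℤ × ℤ} (hp : p ∈ Lam n) : p ≠ -p := by
  intro h
  rw [mem_Lam] at hp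
  have h1 : p.1 = -p.1 := congrArg Prod.fst h
  have h2 : p.2 = -p.2 := congrArg Prod.snd h
  have h1 : p.1 = 0 := by omega
  have h2 : p.2 = 0 := by omega
  rw [h1, h2] at hp
  simp at hp
  omega

/-- A vector of the plane orthogonal to two nonzero orthogonal vectors vanishes. -/
theorem eq_zero_of_orthogonal {u v w : ℤ × ℤ} (hu : u ≠ 0) (hv : v ≠ 0)
    (huv : u.1 * v.1 + u.2 * v.2 = 0) (hwu : w.1 * u.1 + w.2 * u.2 = 0)
    (hwv : w.1 * v.1 + w.2 * v.2 = 0) : w = 0 := by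
  have norm_ne {x : ℤ × ℤ} (hx : x ≠ 0) : x.1 ^ 2 + x.2 ^ 2 ≠ 0 := fun h =>
    hx (Prod.ext (by simpa using show x.1 = 0 by nlinarith [sq_nonneg x.1, sq_nonneg x.2])
      (by simpa using show x.2 = 0 by nlinarith [sq_nonneg x.1, sq_nonneg x.2]))
  have hdet : u.1 * v.2 - u.2 * v.1 ≠ 0 := by
    intro h
    have : (u.1 ^ 2 + u.2 ^ 2) * (v.1 ^ 2 + v.2 ^ 2) = 0 := by
      linear_combination (u.1 * v.2 - u.2 * v.1) * h + (u.1 * v.1 + u.2 * v.2) * huv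
    exact mul_ne_zero (norm_ne hu) (norm_ne hv) this
  have h1 : w.1 * (u.1 * v.2 - u.2 * v.1) = 0 := by
    linear_combination v.2 * hwu - u.2 * hwv
  have h2 : w.2 * (u.1 * v.2 - u.2 * v.1) = 0 := by
    linear_combination u.1 * hwv - v.1 * hwu
  exact Prod.ext ((mul_eq_zero.mp h1).resolve_right hdet)
    ((mul_eq_zero.mp h2).resolve_right hdet)

/-- The trivial solutions of `p - q + r - s = 0` are the only ones on a circle. -/
theorem mem_S4_iff {n : ℕ} {p q r s : ℤ × ℤ} :
    (p, q, r, s) ∈ S4 n ↔ p ∈ Lam n ∧ q ∈ Lam n ∧ r ∈ Lam n ∧ s ∈ Lam n ∧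
      ((p = q ∧ r = s) ∨ (p = -r ∧ q = -s) ∨ (p = s ∧ q = r)) := by
  simp only [S4, Finset.mem_filter, Finset.mem_product, and_assoc]
  refine and_congr_right fun hp => and_congr_right fun hq => and_congr_right fun hr =>
    and_congr_right fun hs => ⟨fun h => ?_, ?_⟩
  · rw [mem_Lam] at hp hq hr hs
    have hr' : r = q + s - p := by linear_combination h
    by_cases hpq : p = q
    · subst hpq
      exact Or.inl ⟨rfl, by simpa using hr'⟩
    by_cases hps : p = s
    · subst hps
      exact Or.inr (Or.inr ⟨rfl, by simpa using hr'.symm⟩)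
    subst hr'
    simp only [Prod.fst_add, Prod.fst_sub, Prod.snd_add, Prod.snd_sub] at hr
    have huv : (p - q).1 * (p - s).1 + (p - q).2 * (p - s).2 = 0 := by
      simp only [Prod.fst_sub, Prod.snd_sub]
      nlinarith
    have hw : q + s = 0 := by
      refine eq_zero_of_orthogonal (sub_ne_zero.mpr hpq) (sub_ne_zero.mpr hps) huv ?_ ?_ <;>
      simp only [Prod.fst_sub, Prod.snd_sub, Prod.fst_add, Prod.snd_add] at * <;>
      nlinarith
    exact Or.inr (Or.inl ⟨by rw [hw]; simp, eq_neg_of_add_eq_zero_left hw⟩)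
  · rintro (⟨rfl, rfl⟩ | ⟨rfl, rfl⟩ | ⟨rfl, rfl⟩) <;> simp

theorem card_offDiag_filter_ne_neg {n : ℕ} (hn : 1 ≤ n) :
    (((Lam n).offDiag.filter fun x => x.1 ≠ -x.2).card) + Nn n = Nn n * Nn n - Nn n := by
  have hneg : ((Lam n).offDiag.filter fun x => x.1 = -x.2) =
      (Lam n).image fun p => (p, -p) := by
    ext ⟨p, q⟩
    simp only [Finset.mem_filter, Finset.mem_offDiag, Finset.mem_image, Prod.mk.injEq]
    constructor
    · rintro ⟨⟨hp, -, -⟩, h⟩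
      exact ⟨p, hp, rfl, by rw [h, neg_neg]⟩
    · rintro ⟨p, hp, rfl, rfl⟩
      exact ⟨⟨hp, neg_mem_Lam hp, ne_neg_of_mem_Lam hn hp⟩, (neg_neg p).symm⟩
  have hcard : ((Lam n).image fun p => (p, -p)).card = Nn n :=
    Finset.card_image_of_injective _ fun _ _ h => congrArg Prod.fst h
  have h := Finset.card_filter_add_card_filter_not (s := (Lam n).offDiag)
    fun x : (ℤ × ℤ) × (ℤ × ℤ) => x.1 = -x.2
  rw [hneg, hcard, Finset.offDiag_card, add_comm] at h
  exact h

theorem S4_eq_union {n : ℕ} :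
    S4 n = (((Lam n ×ˢ Lam n).image fun x => (x.1, x.1, x.2, x.2)) ∪
      ((Lam n).offDiag.image fun x => (x.1, x.2, -x.1, -x.2))) ∪
      (((Lam n).offDiag.filter fun x => x.1 ≠ -x.2).image
        fun x => (x.1, x.2, x.2, x.1)) := by
  ext ⟨p, q, r, s⟩
  simp only [mem_S4_iff, Finset.mem_union, Finset.mem_image, Finset.mem_product,
    Finset.mem_filter, Finset.mem_offDiag, Prod.mk.injEq]
  constructor
  · rintro ⟨hp, hq, hr, hs, h⟩
    by_cases hpq : p = q
    · left; left
      subst hpq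
      refine ⟨(p, r), ⟨hp, hr⟩, rfl, rfl, rfl, ?_⟩
      rcases h with ⟨-, h⟩ | ⟨h, h'⟩ | ⟨h, h'⟩
      · exact h
      · exact neg_injective (h.symm.trans h')
      · exact h'.symm.trans h
    · rcases h with ⟨h, -⟩ | ⟨h, h'⟩ | ⟨h, h'⟩
      · exact absurd h hpq
      · exact Or.inl (Or.inr ⟨(p, q), ⟨hp, hq, hpq⟩, rfl, rfl, by simp [h], by simp [h']⟩)
      · subst h h'
        by_cases hn : p = -q
        · exact Or.inl (Or.inr ⟨(p, q), ⟨hp, hq, hpq⟩, rfl, rfl, by simp [hn], hn.symm⟩)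
        · exact Or.inr ⟨(p, q), ⟨⟨hp, hq, hpq⟩, hn⟩, rfl, rfl, rfl, rfl⟩
  · rintro ((⟨⟨a, b⟩, ⟨ha, hb⟩, rfl, rfl, rfl, rfl⟩ | ⟨⟨a, b⟩, ⟨ha, hb, -⟩, rfl, rfl, rfl, rfl⟩) |
      ⟨⟨a, b⟩, ⟨⟨ha, hb, -⟩, -⟩, rfl, rfl, rfl, rfl⟩)
    · exact ⟨ha, ha, hb, hb, Or.inl ⟨rfl, rfl⟩⟩
    · exact ⟨ha, hb, neg_mem_Lam ha, neg_mem_Lam hb, Or.inr (Or.inl (by simp))⟩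
    · exact ⟨ha, hb, hb, ha, Or.inr (Or.inr ⟨rfl, rfl⟩)⟩

theorem card_S4 {n : ℕ} (hn : 1 ≤ n) : (S4 n).card = 3 * Nn n * (Nn n - 1) := by
  have hdisj₁ : Disjoint ((Lam n ×ˢ Lam n).image fun x => (x.1, x.1, x.2, x.2))
      ((Lam n).offDiag.image fun x => (x.1, x.2, -x.1, -x.2)) := by
    simp only [Finset.disjoint_left, Finset.mem_image, Finset.mem_offDiag]
    rintro _ ⟨x, -, rfl⟩ ⟨y, ⟨-, -, hy⟩, h⟩
    simp only [Prod.mk.injEq] at h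
    exact hy (h.1.trans h.2.1.symm)
  have hdisj₂ : Disjoint (((Lam n ×ˢ Lam n).image fun x => (x.1, x.1, x.2, x.2)) ∪
      ((Lam n).offDiag.image fun x => (x.1, x.2, -x.1, -x.2)))
      (((Lam n).offDiag.filter fun x => x.1 ≠ -x.2).image fun x => (x.1, x.2, x.2, x.1)) := by
    simp only [Finset.disjoint_left, Finset.mem_union, Finset.mem_image, Finset.mem_filter,
      Finset.mem_offDiag]
    rintro _ (⟨x, -, rfl⟩ | ⟨x, -, rfl⟩) ⟨y, ⟨⟨-, -, hy⟩, hy'⟩, h⟩ <;>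
      simp only [Prod.mk.injEq] at h
    · exact hy (h.1.trans h.2.1.symm)
    · exact hy' (by rw [h.2.2.1, neg_neg]; exact h.1)
  rw [S4_eq_union, Finset.card_union_of_disjoint hdisj₂, Finset.card_union_of_disjoint hdisj₁,
    Finset.card_image_of_injective, Finset.card_image_of_injective,
    Finset.card_image_of_injective, Finset.card_product, Finset.offDiag_card]
  · have h := card_offDiag_filter_ne_neg hn
    change Nn n * Nn n + (Nn n * Nn n - Nn n) + _ = _
    rw [mul_assoc, Nat.mul_sub, mul_one]
    have := Nat.le_mul_self (Nn n)
    omega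
  all_goals
    rintro ⟨a, b⟩ ⟨c, d⟩ h
    simp only [Prod.mk.injEq] at h ⊢
    tauto

/-- **Zygmund's lemma.** Every element of `S₄(n)` has exactly one of the four
mutually exclusive structures (a)–(d); consequently `|S₄(n)| = 3𝒩_n(𝒩_n − 1)`. -/
theorem four_correlations_structure (n : ℕ) (hn : inS n) :
    (∀ q ∈ S4 n,
      letI l := q.1; letI l' := q.2.1; letI l'' := q.2.2.1; letI l''' := q.2.2.2
      letI A : Prop := l = l' ∧ l'' = l'''
      letI B : Prop := l = -l' ∧ l = -l'' ∧ l = l'''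
      letI C : Prop := l ≠ l' ∧ l ≠ -l' ∧ l = -l'' ∧ l' = -l'''
      letI D : Prop := l ≠ l' ∧ l ≠ -l' ∧ l = l''' ∧ l' = l''
      (A ∧ ¬B ∧ ¬C ∧ ¬D) ∨ (¬A ∧ B ∧ ¬C ∧ ¬D) ∨ (¬A ∧ ¬B ∧ C ∧ ¬D) ∨ (¬A ∧ ¬B ∧ ¬C ∧ D)) ∧
    (S4 n).card = 3 * Nn n * (Nn n - 1) := by
  refine ⟨?_, card_S4 hn.1⟩
  rintro ⟨p, q, r, s⟩ h
  obtain ⟨hp, -, -, -, h⟩ := mem_S4_iff.mp h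
  have hne := ne_neg_of_mem_Lam hn.1 hp
  dsimp only
  rcases h with ⟨rfl, rfl⟩ | ⟨h, h'⟩ | ⟨rfl, rfl⟩
  · exact Or.inl ⟨⟨rfl, rfl⟩, fun h => hne h.1, fun h => h.1 rfl, fun h => h.1 rfl⟩
  · obtain rfl : r = -p := by rw [h, neg_neg]
    obtain rfl : s = -q := by rw [h', neg_neg]
    by_cases h₁ : p = q
    · subst h₁
      exact Or.inl ⟨⟨rfl, rfl⟩, fun h => hne h.1, fun h => h.1 rfl, fun h => h.1 rfl⟩
    by_cases h₂ : p = -q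
    · exact Or.inr (Or.inl ⟨fun h => h₁ h.1, ⟨h₂, (neg_neg p).symm, h₂⟩,
        fun h => h.2.1 h₂, fun h => h.2.1 h₂⟩)
    · exact Or.inr (Or.inr (Or.inl ⟨fun h => h₁ h.1, fun h => h₂ h.1,
        ⟨h₁, h₂, (neg_neg p).symm, (neg_neg q).symm⟩, fun h => h₂ h.2.2.1⟩))
  · by_cases h₁ : p = q
    · subst h₁
      exact Or.inl ⟨⟨rfl, rfl⟩, fun h => hne h.1, fun h => h.1 rfl, fun h => h.1 rfl⟩
    by_cases h₂ : p = -q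
    · exact Or.inr (Or.inl ⟨fun h => h₁ h.1, ⟨h₂, h₂, rfl⟩, fun h => h.2.1 h₂, fun h => h.2.1 h₂⟩)
    · exact Or.inr (Or.inr (Or.inr ⟨fun h => h₁ h.1, fun h => h₂ h.1, fun h => h₂ h.2.2.1,
        ⟨h₁, h₂, rfl, rfl⟩⟩))

end
end

section
/- If the nonnegative integers a, b, c, d do not all have the same parity (i.e., at least one of them is even and at least one is odd), then α_{a,b,c,d} = 0. -/
open MeasureTheory ProbabilityTheory

noncomputable section

/-- The `k`-th probabilists' Hermite polynomial, as a function `ℝ → ℝ`. -/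
def H (k : ℕ) (t : ℝ) : ℝ := Polynomial.aeval t (Polynomial.hermite k)

/-- The law of 4 i.i.d. standard Gaussian random variables `(X, Y, V, W)`. -/
def gauss4 : Measure (Fin 4 → ℝ) := Measure.pi fun _ => gaussianReal 0 1

/-- `α_{a,b,c,d} = E[|XW − YV| H_a(X) H_b(Y) H_c(V) H_d(W)]` for `(X,Y,V,W)` a standard
Gaussian vector of `ℝ⁴`. -/
def alphaCoef (a b c d : ℕ) : ℝ :=
  ∫ x : Fin 4 → ℝ,
    |x 0 * x 3 - x 1 * x 2| * H a (x 0) * H b (x 1) * H c (x 2) * H d (x 3) ∂gauss4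


theorem hermite_comp_neg_X (k : ℕ) :
    (Polynomial.hermite k).comp (-Polynomial.X) = (-1) ^ k * Polynomial.hermite k := by
  induction k with
  | zero => simp
  | succ k ih =>
    have h := congrArg Polynomial.derivative ih
    rw [Polynomial.derivative_comp,
      show ((-1 : Polynomial ℤ) ^ k) = Polynomial.C ((-1) ^ k) by simp,
      Polynomial.derivative_C_mul] at h
    simp only [Polynomial.derivative_X, map_pow, map_neg, map_one] at h
    rw [Polynomial.hermite_succ, Polynomial.sub_comp, Polynomial.mul_comp, ih,
      Polynomial.X_comp, pow_succ]
    linear_combination h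

theorem H_neg (k : ℕ) (t : ℝ) : H k (-t) = (-1) ^ k * H k t := by
  have h := congrArg (Polynomial.aeval t) (hermite_comp_neg_X k)
  simpa [H, Polynomial.aeval_comp] using h

theorem H_sign_mul (k : ℕ) {s : ℝ} (hs : s = 1 ∨ s = -1) (t : ℝ) :
    H k (s * t) = s ^ k * H k t := by
  rcases hs with rfl | rfl
  · simp
  · rw [neg_one_mul, H_neg]

theorem continuous_H (k : ℕ) : Continuous (H k) :=
  (Polynomial.hermite k).continuous_aeval

theorem measurePreserving_gauss4_sign_mul {s : Fin 4 → ℝ} (hs : ∀ i, s i = 1 ∨ s i = -1) :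
    MeasurePreserving (fun (x : Fin 4 → ℝ) i => s i * x i) gauss4 gauss4 := by
  refine measurePreserving_pi _ _ fun i => ⟨by fun_prop, ?_⟩
  rw [gaussianReal_map_const_mul, mul_zero]
  congr 1
  ext
  rcases hs i with h | h <;> simp [h]

theorem alphaCoef_eq_sign_mul (a b c d : ℕ) {s : Fin 4 → ℝ} (hs : ∀ i, s i = 1 ∨ s i = -1)
    (hprod : s 0 * s 3 = s 1 * s 2) :
    alphaCoef a b c d = s 0 ^ a * s 1 ^ b * s 2 ^ c * s 3 ^ d * alphaCoef a b c d := by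
  have habs : |s 1 * s 2| = 1 := by
    rcases hs 1 with h₁ | h₁ <;> rcases hs 2 with h₂ | h₂ <;> simp [h₁, h₂]
  have hmp := measurePreserving_gauss4_sign_mul hs
  have := continuous_H a
  have := continuous_H b
  have := continuous_H c
  have := continuous_H d
  have hcont : Continuous fun x : Fin 4 → ℝ =>
      |x 0 * x 3 - x 1 * x 2| * H a (x 0) * H b (x 1) * H c (x 2) * H d (x 3) := by
    fun_prop
  conv_lhs => rw [alphaCoef, ← hmp.map_eq]
  rw [integral_map hmp.aemeasurable hcont.aestronglyMeasurable, alphaCoef,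
    ← integral_const_mul]
  congr 1 with x
  have hdet : s 0 * x 0 * (s 3 * x 3) - s 1 * x 1 * (s 2 * x 2) =
      s 1 * s 2 * (x 0 * x 3 - x 1 * x 2) := by
    linear_combination x 0 * x 3 * hprod
  simp only [H_sign_mul _ (hs _), hdet, abs_mul (s 1 * s 2), habs]
  ring

theorem eq_zero_of_eq_neg_one_pow_mul {m n : ℕ} {r : ℝ} (hr : r = (-1) ^ m * (-1) ^ n * r)
    (hmn : ¬(Even m ↔ Even n)) : r = 0 := by
  rw [← pow_add, Odd.neg_one_pow (by rwa [← Nat.not_even_iff_odd, Nat.even_add])] at hr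
  linarith

/-- If the nonnegative integers `a, b, c, d` do not all have the same parity,
then `α_{a,b,c,d} = 0`. -/
theorem alphaCoef_eq_zero_of_mixed_parity (a b c d : ℕ)
    (h : ¬((Even a ∧ Even b ∧ Even c ∧ Even d) ∨ (Odd a ∧ Odd b ∧ Odd c ∧ Odd d))) :
    alphaCoef a b c d = 0 := by
  by_contra hne
  have hab : Even a ↔ Even b := by
    by_contra hmix
    refine hne (eq_zero_of_eq_neg_one_pow_mul ?_ hmix)
    simpa using alphaCoef_eq_sign_mul a b c d (s := ![-1, -1, 1, 1])
      (by simp [Fin.forall_fin_succ]) (by simp)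
  have hac : Even a ↔ Even c := by
    by_contra hmix
    refine hne (eq_zero_of_eq_neg_one_pow_mul ?_ hmix)
    simpa using alphaCoef_eq_sign_mul a b c d (s := ![-1, 1, -1, 1])
      (by simp [Fin.forall_fin_succ]) (by simp)
  have had : Even a ↔ Even d := by
    by_contra hmix
    refine hne (eq_zero_of_eq_neg_one_pow_mul ?_ hmix)
    simpa using alphaCoef_eq_sign_mul a b c d (s := ![-1, 1, 1, -1])
      (by simp [Fin.forall_fin_succ]) (by simp)
  simp only [← Nat.not_even_iff_odd] at h
  tauto

end
end

section
/- The following explicit values hold: α_{0,0,0,0} = 1; α_{2,0,0,0} = α_{0,2,0,0} = α_{0,0,2,0} = α_{0,0,0,2} = 1/2; α_{4,0,0,0} = α_{0,4,0,0} = α_{0,0,4,0} = α_{0,0,0,4} = −3/8; α_{2,2,0,0} = α_{0,0,2,2} = −1/8; α_{2,0,2,0} = α_{0,2,0,2} = −1/8; α_{2,0,0,2} = α_{0,2,2,0} = 5/8; and α_{1,1,1,1} = −3/8. -/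
open MeasureTheory ProbabilityTheory

noncomputable section

open Real Set

/-- The raw moment `E[|XW − YV| X^a Y^b V^c W^d]`. -/
def detMoment (a b c d : ℕ) : ℝ :=
  ∫ x : Fin 4 → ℝ,
    |x 0 * x 3 - x 1 * x 2| * (x 0 ^ a * x 1 ^ b * x 2 ^ c * x 3 ^ d) ∂gauss4

/-- The unnormalized `n`-th moment of the Rayleigh distribution. -/
def rayleighMoment (n : ℕ) : ℝ := ∫ r in Ioi (0 : ℝ), r ^ n * (r * exp (-r ^ 2 / 2))

lemma rayleighMoment_eq (n : ℕ) :
    rayleighMoment n =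
      (1 / 2 : ℝ) ^ (-((n : ℝ) + 2) / 2) * (1 / 2) * Gamma (((n : ℝ) + 2) / 2) := by
  have h := integral_rpow_mul_exp_neg_mul_rpow (p := 2) (q := n + 1) (b := 1 / 2)
    (by norm_num) (by linarith [n.cast_nonneg (α := ℝ)]) (by norm_num)
  rw [show (n : ℝ) + 1 + 1 = n + 2 by ring] at h
  rw [← h]
  refine setIntegral_congr_fun measurableSet_Ioi fun r _ => ?_
  have h1 : r ^ ((n : ℝ) + 1) = r ^ (n + 1) := by exact_mod_cast rpow_natCast r (n + 1)
  have h2 : r ^ (2 : ℝ) = r ^ 2 := by exact_mod_cast rpow_natCast r 2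
  simp only [h1, h2]
  rw [show -r ^ 2 / 2 = -(1 / 2) * r ^ 2 by ring]
  ring

lemma rayleighMoment_add_two (n : ℕ) :
    rayleighMoment (n + 2) = (n + 2) * rayleighMoment n := by
  rw [rayleighMoment_eq, rayleighMoment_eq]
  push_cast
  rw [show ((n : ℝ) + 2 + 2) / 2 = (n + 2) / 2 + 1 by ring, Gamma_add_one (by positivity),
    show -((n : ℝ) + 2 + 2) / 2 = -(n + 2) / 2 - 1 by ring,
    rpow_sub_one (by norm_num)]
  ring

lemma rayleighMoment_one_sq : rayleighMoment 1 ^ 2 = π / 2 := by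
  rw [rayleighMoment_eq]
  norm_num only [Nat.cast_one]
  rw [show (3 / 2 : ℝ) = 1 / 2 + 1 by norm_num, Gamma_add_one (by norm_num), Gamma_one_half_eq,
    mul_pow, mul_pow, mul_pow, sq_sqrt pi_pos.le, ← rpow_natCast, ← rpow_mul (by norm_num),
    show (-(1 / 2 + 1) : ℝ) * (2 : ℕ) = ((-3 : ℤ) : ℝ) by norm_num, rpow_intCast]
  norm_num
  ring

/-- Integration in polar coordinates against the standard Gaussian measure of the plane, for
functions which separate in polar coordinates. -/
lemma integral_gaussianReal_prod_of_polar {f : ℝ × ℝ → ℝ} {g h : ℝ → ℝ}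
    (hf : ∀ r θ, 0 < r → f (r * cos θ, r * sin θ) = g r * h θ) :
    ∫ p, f p ∂(gaussianReal 0 1).prod (gaussianReal 0 1) =
      (∫ r in Ioi (0 : ℝ), g r * (r * exp (-r ^ 2 / 2))) *
        ((2 * π)⁻¹ * ∫ θ in -π..π, h θ) := by
  have hpdf : ∀ x y : ℝ, gaussianPDFReal 0 1 x * gaussianPDFReal 0 1 y =
      (2 * π)⁻¹ * exp (-(x ^ 2 + y ^ 2) / 2) := by
    intro x y
    simp only [gaussianPDFReal, NNReal.coe_one, mul_one, sub_zero]
    rw [show ∀ a b c d : ℝ, a * b * (c * d) = a * c * (b * d) by intros; ring, ← exp_add,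
      ← mul_inv, mul_self_sqrt (by positivity)]
    congr 2
    ring
  rw [gaussianReal_of_var_ne_zero _ one_ne_zero,
    prod_withDensity (measurable_gaussianPDF _ _) (measurable_gaussianPDF _ _),
    integral_withDensity_eq_integral_toReal_smul
      (by fun_prop)
      (ae_of_all _ fun _ => ENNReal.mul_lt_top gaussianPDF_lt_top gaussianPDF_lt_top),
    ← Measure.volume_eq_prod, ← integral_comp_polarCoord_symm, polarCoord_target,
    intervalIntegral.integral_of_le (by linarith [pi_pos]), integral_Ioc_eq_integral_Ioo,
    ← integral_const_mul, Measure.volume_eq_prod, ← setIntegral_prod_mul]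
  refine setIntegral_congr_fun (measurableSet_Ioi.prod measurableSet_Ioo) fun p hp => ?_
  simp only [polarCoord_symm_apply, ENNReal.toReal_mul, toReal_gaussianPDF, hpdf, smul_eq_mul,
    hf _ _ hp.1]
  rw [show (p.1 * cos p.2) ^ 2 + (p.1 * sin p.2) ^ 2 = p.1 ^ 2 by
    linear_combination p.1 ^ 2 * sin_sq_add_cos_sq p.2]
  ring

/-- Regrouping two pairs of real numbers into a vector. -/
def vecOfPairs (p : (ℝ × ℝ) × (ℝ × ℝ)) : Fin 4 → ℝ := ![p.1.1, p.1.2, p.2.1, p.2.2]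

lemma measurable_vecOfPairs : Measurable vecOfPairs := by
  refine measurable_pi_lambda _ fun i => ?_
  fin_cases i <;> simp only [vecOfPairs] <;> simp <;> fun_prop

lemma gauss4_eq_map :
    gauss4 = (((gaussianReal 0 1).prod (gaussianReal 0 1)).prod
      ((gaussianReal 0 1).prod (gaussianReal 0 1))).map vecOfPairs := by
  refine Measure.pi_eq fun s hs => ?_
  rw [Measure.map_apply measurable_vecOfPairs (MeasurableSet.univ_pi hs)]
  have : vecOfPairs ⁻¹' univ.pi s = (s 0 ×ˢ s 1) ×ˢ (s 2 ×ˢ s 3) := by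
    ext p
    simp [vecOfPairs, Fin.forall_fin_succ, and_assoc]
  rw [this, Measure.prod_prod, Measure.prod_prod, Measure.prod_prod]
  simp [Fin.prod_univ_four, mul_assoc]

lemma integrable_pow_gauss4 (a b c d : ℕ) :
    Integrable (fun x : Fin 4 → ℝ => x 0 ^ a * x 1 ^ b * x 2 ^ c * x 3 ^ d) gauss4 := by
  have h1 : ∀ n : ℕ, Integrable (fun t : ℝ => t ^ n) (gaussianReal 0 1) := fun n =>
    integrable_pow_of_mem_interior_integrableExpSet (X := id) (by simp) n
  have := Integrable.fintype_prod (μ := fun _ : Fin 4 => gaussianReal 0 1)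
    (f := fun i t => t ^ (![a, b, c, d] i)) fun i => h1 _
  simpa [Fin.prod_univ_four] using! this

lemma integrable_detMoment (a b c d : ℕ) :
    Integrable (fun x : Fin 4 → ℝ =>
      |x 0 * x 3 - x 1 * x 2| * (x 0 ^ a * x 1 ^ b * x 2 ^ c * x 3 ^ d)) gauss4 := by
  refine ((integrable_pow_gauss4 (a + 1) b c (d + 1)).sub
    (integrable_pow_gauss4 a (b + 1) (c + 1) d)).mono (by fun_prop) (ae_of_all _ fun x => ?_)
  refine le_of_eq ?_
  rw [norm_mul, norm_eq_abs |_|, abs_abs, ← norm_eq_abs, ← norm_mul]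
  simp only [Pi.sub_apply]
  congr 1
  ring

lemma detMoment_eq_of_angular (a b c d : ℕ) {A : ℝ → ℝ}
    (hA : ∀ θ, ∫ φ in -π..π, |sin (φ - θ)| * (cos φ ^ c * sin φ ^ d) = A θ) :
    detMoment a b c d = rayleighMoment (a + b + 1) * rayleighMoment (c + d + 1) *
      ((2 * π)⁻¹ ^ 2 * ∫ θ in -π..π, cos θ ^ a * sin θ ^ b * A θ) := by
  have hint := integrable_detMoment a b c d
  rw [gauss4_eq_map] at hint
  rw [detMoment, gauss4_eq_map, integral_map measurable_vecOfPairs.aemeasurable (by fun_prop),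
    integral_prod _ (by exact hint.comp_measurable measurable_vecOfPairs),
    integral_gaussianReal_prod_of_polar (g := fun r => r ^ (a + b + 1))
      (h := fun θ => rayleighMoment (c + d + 1) * (2 * π)⁻¹ * (cos θ ^ a * sin θ ^ b * A θ)),
    intervalIntegral.integral_const_mul, ← rayleighMoment]
  · ring
  intro r θ hr
  rw [integral_gaussianReal_prod_of_polar (g := fun s => r ^ (a + b + 1) * s ^ (c + d + 1))
      (h := fun φ => cos θ ^ a * sin θ ^ b * (|sin (φ - θ)| * (cos φ ^ c * sin φ ^ d))),
    intervalIntegral.integral_const_mul, hA]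
  · simp only [mul_assoc (r ^ (a + b + 1)), integral_const_mul, rayleighMoment]
    ring
  intro s φ hs
  simp only [vecOfPairs, Matrix.cons_val]
  rw [show r * cos θ * (s * sin φ) - r * sin θ * (s * cos φ) = r * s * sin (φ - θ) by
    rw [sin_sub]; ring, abs_mul, abs_of_pos (mul_pos hr hs)]
  ring

lemma integral_abs_sin_mul (A B C : ℝ) :
    ∫ t in -π..π, |sin t| * (A + B * sin t ^ 2 + C * (sin t * cos t)) = 4 * A + 8 / 3 * B := by
  have hc : Continuous fun t => sin t * (A + B * sin t ^ 2 + C * (sin t * cos t)) := by fun_prop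
  have hd : ∀ t, HasDerivAt
      (fun t => -A * cos t + B * (cos t ^ 3 / 3 - cos t) + C * (sin t ^ 3 / 3))
      (sin t * (A + B * sin t ^ 2 + C * (sin t * cos t))) t := by
    intro t
    convert! (((hasDerivAt_cos t).const_mul (-A)).add
      (((((hasDerivAt_cos t).pow 3).div_const 3).sub (hasDerivAt_cos t)).const_mul B)).add
      ((((hasDerivAt_sin t).pow 3).div_const 3).const_mul C) using 1
    push_cast
    linear_combination B * sin t * sin_sq_add_cos_sq t
  have hF : ∀ a b : ℝ, _ := fun a b =>
    intervalIntegral.integral_eq_sub_of_hasDerivAt (a := a) (b := b) (fun t _ => hd t)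
      (hc.intervalIntegrable _ _)
  have hi : ∀ a b : ℝ, IntervalIntegrable
      (fun t => |sin t| * (A + B * sin t ^ 2 + C * (sin t * cos t))) volume a b := fun a b =>
    Continuous.intervalIntegrable (by fun_prop) _ _
  have hneg : ∫ t in -π..0, |sin t| * (A + B * sin t ^ 2 + C * (sin t * cos t)) =
      ∫ t in -π..0, -(sin t * (A + B * sin t ^ 2 + C * (sin t * cos t))) := by
    refine intervalIntegral.integral_congr fun t ht => ?_
    rw [uIcc_of_le (by linarith [pi_pos])] at ht
    simp only [abs_of_nonpos (sin_nonpos_of_nonpos_of_neg_pi_le ht.2 ht.1), neg_mul]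
  have hpos : ∫ t in 0..π, |sin t| * (A + B * sin t ^ 2 + C * (sin t * cos t)) =
      ∫ t in 0..π, sin t * (A + B * sin t ^ 2 + C * (sin t * cos t)) := by
    refine intervalIntegral.integral_congr fun t ht => ?_
    rw [uIcc_of_le pi_pos.le] at ht
    simp only [abs_of_nonneg (sin_nonneg_of_mem_Icc ht)]
  rw [← intervalIntegral.integral_add_adjacent_intervals (hi (-π) 0) (hi 0 π), hneg, hpos,
    intervalIntegral.integral_neg, hF, hF]
  simp
  ring

lemma integral_abs_sin_sub_mul {f : ℝ → ℝ} (hf : Function.Periodic f (2 * π)) {θ A B C : ℝ}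
    (h : ∀ t, f (t + θ) = A + B * sin t ^ 2 + C * (sin t * cos t)) :
    ∫ φ in -π..π, |sin (φ - θ)| * f φ = 4 * A + 8 / 3 * B := by
  have hper : Function.Periodic (fun t => |sin t| * f (t + θ)) (2 * π) := fun t => by
    simp only [sin_add_two_pi, show t + 2 * π + θ = t + θ + 2 * π by ring, hf (t + θ)]
  have h1 := intervalIntegral.integral_comp_sub_right (a := -π) (b := π)
    (fun t => |sin t| * f (t + θ)) θ
  simp only [sub_add_cancel] at h1
  have h2 := hper.intervalIntegral_add_eq (-π - θ) (-π)
  rw [show -π - θ + 2 * π = π - θ by ring, show -π + 2 * π = π by ring] at h2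
  rw [h1, h2, ← integral_abs_sin_mul A B C]
  simp only [h]

lemma detMoment_zero_zero (a b : ℕ) :
    detMoment a b 0 0 = rayleighMoment (a + b + 1) * rayleighMoment 1 *
      ((2 * π)⁻¹ ^ 2 * ∫ θ in -π..π, cos θ ^ a * sin θ ^ b * 4) := by
  refine detMoment_eq_of_angular a b 0 0 fun θ => ?_
  rw [integral_abs_sin_sub_mul (f := fun φ => cos φ ^ 0 * sin φ ^ 0) (A := 1) (B := 0) (C := 0)]
  · norm_num
  · intro; simp
  · intro; simp

lemma detMoment_zero_two (a b : ℕ) :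
    detMoment a b 0 2 = rayleighMoment (a + b + 1) * rayleighMoment 3 *
      ((2 * π)⁻¹ ^ 2 * ∫ θ in -π..π, cos θ ^ a * sin θ ^ b * (4 / 3 + 4 / 3 * cos θ ^ 2)) := by
  refine detMoment_eq_of_angular a b 0 2 fun θ => ?_
  rw [integral_abs_sin_sub_mul (f := fun φ => cos φ ^ 0 * sin φ ^ 2) (A := sin θ ^ 2)
    (B := cos θ ^ 2 - sin θ ^ 2) (C := 2 * sin θ * cos θ)]
  · linear_combination 4 / 3 * sin_sq_add_cos_sq θ
  · intro; simp
  · intro t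
    rw [sin_add]
    linear_combination sin θ ^ 2 * sin_sq_add_cos_sq t

lemma detMoment_one_one (a b : ℕ) :
    detMoment a b 1 1 = rayleighMoment (a + b + 1) * rayleighMoment 3 *
      ((2 * π)⁻¹ ^ 2 * ∫ θ in -π..π, cos θ ^ a * sin θ ^ b * (-(4 / 3) * (sin θ * cos θ))) := by
  refine detMoment_eq_of_angular a b 1 1 fun θ => ?_
  rw [integral_abs_sin_sub_mul (f := fun φ => cos φ ^ 1 * sin φ ^ 1) (A := sin θ * cos θ)
    (B := -2 * (sin θ * cos θ)) (C := cos θ ^ 2 - sin θ ^ 2)]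
  · ring
  · intro; simp
  · intro t
    rw [sin_add, cos_add]
    linear_combination sin θ * cos θ * sin_sq_add_cos_sq t

lemma rayleighMoment_three : rayleighMoment 3 = 3 * rayleighMoment 1 := by
  rw [rayleighMoment_add_two 1]
  norm_num

lemma rayleighMoment_five : rayleighMoment 5 = 15 * rayleighMoment 1 := by
  rw [rayleighMoment_add_two 3, rayleighMoment_three]
  push_cast
  ring

lemma integral_cos_sq_neg_pi_pi : ∫ θ in -π..π, cos θ ^ 2 = π := by
  rw [integral_cos_sq]
  simp

lemma integral_sin_sq_neg_pi_pi : ∫ θ in -π..π, sin θ ^ 2 = π := by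
  rw [integral_sin_sq]
  simp

lemma integral_cos_pow_four_neg_pi_pi : ∫ θ in -π..π, cos θ ^ 4 = 3 / 4 * π := by
  rw [integral_cos_pow 2, integral_cos_sq_neg_pi_pi]
  simp
  ring

lemma integral_cos_sq_mul_sin_sq_neg_pi_pi :
    ∫ θ in -π..π, cos θ ^ 2 * sin θ ^ 2 = π / 4 := by
  simp_rw [mul_comm (cos _ ^ 2), integral_sin_sq_mul_cos_sq]
  rw [mul_neg, sin_neg, show 4 * π = (4 : ℕ) * π by norm_num, sin_nat_mul_pi]
  ring

lemma rayleighMoment_one_mul_self (κ : ℝ) :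
    rayleighMoment 1 * rayleighMoment 1 * ((2 * π)⁻¹ ^ 2 * (κ * π)) = κ / 8 := by
  rw [← sq, rayleighMoment_one_sq]
  field_simp
  ring

lemma detMoment_0000 : detMoment 0 0 0 0 = 1 := by
  have h : ∫ θ in -π..π, cos θ ^ 0 * sin θ ^ 0 * 4 = 8 * π := by
    simp
    ring
  rw [detMoment_zero_zero, h]
  linear_combination rayleighMoment_one_mul_self 8

lemma detMoment_2000 : detMoment 2 0 0 0 = 3 / 2 := by
  rw [detMoment_zero_zero, intervalIntegral.integral_mul_const]
  simp only [pow_zero, mul_one, integral_cos_sq_neg_pi_pi, Nat.reduceAdd, rayleighMoment_three]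
  linear_combination 3 * rayleighMoment_one_mul_self 4

lemma detMoment_0200 : detMoment 0 2 0 0 = 3 / 2 := by
  rw [detMoment_zero_zero, intervalIntegral.integral_mul_const]
  simp only [pow_zero, one_mul, integral_sin_sq_neg_pi_pi, Nat.reduceAdd, rayleighMoment_three]
  linear_combination 3 * rayleighMoment_one_mul_self 4

lemma detMoment_4000 : detMoment 4 0 0 0 = 45 / 8 := by
  rw [detMoment_zero_zero, intervalIntegral.integral_mul_const]
  simp only [pow_zero, mul_one, integral_cos_pow_four_neg_pi_pi, Nat.reduceAdd,
    rayleighMoment_five]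
  linear_combination 15 * rayleighMoment_one_mul_self 3

lemma detMoment_2200 : detMoment 2 2 0 0 = 15 / 8 := by
  rw [detMoment_zero_zero, intervalIntegral.integral_mul_const]
  simp only [integral_cos_sq_mul_sin_sq_neg_pi_pi, Nat.reduceAdd, rayleighMoment_five]
  linear_combination 15 * rayleighMoment_one_mul_self 1

lemma detMoment_0002 : detMoment 0 0 0 2 = 3 / 2 := by
  have h : ∫ θ in -π..π, cos θ ^ 0 * sin θ ^ 0 * (4 / 3 + 4 / 3 * cos θ ^ 2) = 4 * π := by
    simp only [pow_zero, one_mul]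
    rw [intervalIntegral.integral_add (Continuous.intervalIntegrable (by fun_prop) _ _)
      (Continuous.intervalIntegrable (by fun_prop) _ _),
      intervalIntegral.integral_const_mul, integral_cos_sq_neg_pi_pi,
      intervalIntegral.integral_const, smul_eq_mul]
    ring
  rw [detMoment_zero_two, h]
  simp only [Nat.reduceAdd, rayleighMoment_three]
  linear_combination 3 * rayleighMoment_one_mul_self 4

lemma detMoment_2002 : detMoment 2 0 0 2 = 21 / 8 := by
  have h : ∫ θ in -π..π, cos θ ^ 2 * sin θ ^ 0 * (4 / 3 + 4 / 3 * cos θ ^ 2) = 7 / 3 * π := by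
    calc _ = ∫ θ in -π..π, (4 / 3 * cos θ ^ 2 + 4 / 3 * cos θ ^ 4) := by
          congr 1; ext θ; ring
      _ = _ := by
          rw [intervalIntegral.integral_add (Continuous.intervalIntegrable (by fun_prop) _ _)
            (Continuous.intervalIntegrable (by fun_prop) _ _),
            intervalIntegral.integral_const_mul, intervalIntegral.integral_const_mul,
            integral_cos_sq_neg_pi_pi, integral_cos_pow_four_neg_pi_pi]
          ring
  rw [detMoment_zero_two, h]
  simp only [Nat.reduceAdd, rayleighMoment_three]
  linear_combination 9 * rayleighMoment_one_mul_self (7 / 3)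

lemma detMoment_1111 : detMoment 1 1 1 1 = -(3 / 8) := by
  have h : ∫ θ in -π..π, cos θ ^ 1 * sin θ ^ 1 * (-(4 / 3) * (sin θ * cos θ)) =
      -(1 / 3) * π := by
    calc _ = ∫ θ in -π..π, -(4 / 3) * (cos θ ^ 2 * sin θ ^ 2) := by
          congr 1; ext θ; ring
      _ = _ := by
          rw [intervalIntegral.integral_const_mul, integral_cos_sq_mul_sin_sq_neg_pi_pi]
          ring
  rw [detMoment_one_one, h]
  simp only [Nat.reduceAdd, rayleighMoment_three]
  linear_combination 9 * rayleighMoment_one_mul_self (-(1 / 3))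

lemma H_zero (t : ℝ) : H 0 t = 1 := by simp [H]

lemma H_one (t : ℝ) : H 1 t = t := by simp [H]

lemma H_two (t : ℝ) : H 2 t = t ^ 2 - 1 := by
  simp [H, Polynomial.hermite_succ]
  ring

lemma H_four (t : ℝ) : H 4 t = t ^ 4 - 6 * t ^ 2 + 3 := by
  simp [H, Polynomial.hermite_succ]
  ring

lemma integral_gauss4_comp_perm (e : Equiv.Perm (Fin 4)) (f : (Fin 4 → ℝ) → ℝ) :
    ∫ x, f (x ∘ e) ∂gauss4 = ∫ x, f x ∂gauss4 := by
  have h := measurePreserving_piCongrLeft (fun _ : Fin 4 => gaussianReal 0 1) e.symm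
  have h2 := h.integral_comp' f
  rw [gauss4, ← h2]
  congr! with x
  ext i
  simpa using! (Equiv.piCongrLeft_apply_apply (fun _ => ℝ) e.symm x (e i)).symm

lemma alphaCoef_swap_rows (a b c d : ℕ) : alphaCoef c d a b = alphaCoef a b c d := by
  rw [alphaCoef, alphaCoef,
    ← integral_gauss4_comp_perm (Equiv.swap 0 2 * Equiv.swap 1 3)]
  congr 1
  ext x
  have h : (Equiv.swap 0 2 * Equiv.swap 1 3 : Equiv.Perm (Fin 4)) 0 = 2 ∧
    (Equiv.swap 0 2 * Equiv.swap 1 3 : Equiv.Perm (Fin 4)) 1 = 3 ∧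
    (Equiv.swap 0 2 * Equiv.swap 1 3 : Equiv.Perm (Fin 4)) 2 = 0 ∧
    (Equiv.swap 0 2 * Equiv.swap 1 3 : Equiv.Perm (Fin 4)) 3 = 1 := by decide
  simp only [Function.comp, h]
  rw [abs_sub_comm, mul_comm (x 3), mul_comm (x 2)]
  ring

lemma alphaCoef_swap_columns (a b c d : ℕ) : alphaCoef b a d c = alphaCoef a b c d := by
  rw [alphaCoef, alphaCoef,
    ← integral_gauss4_comp_perm (Equiv.swap 0 1 * Equiv.swap 2 3)]
  congr 1
  ext x
  have h : (Equiv.swap 0 1 * Equiv.swap 2 3 : Equiv.Perm (Fin 4)) 0 = 1 ∧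
    (Equiv.swap 0 1 * Equiv.swap 2 3 : Equiv.Perm (Fin 4)) 1 = 0 ∧
    (Equiv.swap 0 1 * Equiv.swap 2 3 : Equiv.Perm (Fin 4)) 2 = 3 ∧
    (Equiv.swap 0 1 * Equiv.swap 2 3 : Equiv.Perm (Fin 4)) 3 = 2 := by decide
  simp only [Function.comp, h]
  rw [abs_sub_comm]
  ring

lemma alphaCoef_transpose (a b c d : ℕ) : alphaCoef a c b d = alphaCoef a b c d := by
  rw [alphaCoef, alphaCoef, ← integral_gauss4_comp_perm (Equiv.swap 1 2)]
  congr 1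
  ext x
  have h : (Equiv.swap 1 2 : Equiv.Perm (Fin 4)) 0 = 0 ∧
    (Equiv.swap 1 2 : Equiv.Perm (Fin 4)) 1 = 2 ∧
    (Equiv.swap 1 2 : Equiv.Perm (Fin 4)) 2 = 1 ∧
    (Equiv.swap 1 2 : Equiv.Perm (Fin 4)) 3 = 3 := by decide
  simp only [Function.comp, h]
  rw [mul_comm (x 2) (x 1)]
  ring

lemma alphaCoef_0000 : alphaCoef 0 0 0 0 = 1 := by
  rw [← detMoment_0000, alphaCoef, detMoment]
  simp [H_zero]

lemma alphaCoef_2000 : alphaCoef 2 0 0 0 = 1 / 2 := by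
  have h : alphaCoef 2 0 0 0 = detMoment 2 0 0 0 - detMoment 0 0 0 0 := by
    rw [alphaCoef, detMoment, detMoment,
      ← integral_sub (integrable_detMoment _ _ _ _) (integrable_detMoment _ _ _ _)]
    congr 1
    ext x
    simp only [H_zero, H_two]
    ring
  rw [h, detMoment_2000, detMoment_0000]
  norm_num

lemma alphaCoef_4000 : alphaCoef 4 0 0 0 = -(3 / 8) := by
  have h : alphaCoef 4 0 0 0 =
      detMoment 4 0 0 0 - 6 * detMoment 2 0 0 0 + 3 * detMoment 0 0 0 0 := by
    have h4 := integrable_detMoment 4 0 0 0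
    have h2 := (integrable_detMoment 2 0 0 0).const_mul 6
    have h0 := (integrable_detMoment 0 0 0 0).const_mul 3
    simp only [alphaCoef, detMoment]
    rw [← integral_const_mul, ← integral_const_mul, ← integral_sub h4 h2,
      ← integral_add (by exact h4.sub h2) h0]
    congr 1
    ext x
    simp only [H_zero, H_four]
    ring
  rw [h, detMoment_4000, detMoment_2000, detMoment_0000]
  norm_num

lemma integral_sub_sub_add {α : Type*} {_ : MeasurableSpace α} {μ : Measure α} {f g h k : α → ℝ}
    (hf : Integrable f μ) (hg : Integrable g μ) (hh : Integrable h μ) (hk : Integrable k μ) :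
    ∫ x, (f x - g x - h x + k x) ∂μ =
      ∫ x, f x ∂μ - ∫ x, g x ∂μ - ∫ x, h x ∂μ + ∫ x, k x ∂μ := by
  rw [integral_add (by exact (hf.sub hg).sub hh) hk, integral_sub (by exact hf.sub hg) hh,
    integral_sub hf hg]

lemma alphaCoef_2200 : alphaCoef 2 2 0 0 = -(1 / 8) := by
  have h : alphaCoef 2 2 0 0 =
      detMoment 2 2 0 0 - detMoment 2 0 0 0 - detMoment 0 2 0 0 + detMoment 0 0 0 0 := by
    simp only [alphaCoef, detMoment]
    rw [← integral_sub_sub_add (integrable_detMoment _ _ _ _) (integrable_detMoment _ _ _ _)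
      (integrable_detMoment _ _ _ _) (integrable_detMoment _ _ _ _)]
    congr 1
    ext x
    simp only [H_zero, H_two]
    ring
  rw [h, detMoment_2200, detMoment_2000, detMoment_0200, detMoment_0000]
  norm_num

lemma alphaCoef_2002 : alphaCoef 2 0 0 2 = 5 / 8 := by
  have h : alphaCoef 2 0 0 2 =
      detMoment 2 0 0 2 - detMoment 2 0 0 0 - detMoment 0 0 0 2 + detMoment 0 0 0 0 := by
    simp only [alphaCoef, detMoment]
    rw [← integral_sub_sub_add (integrable_detMoment _ _ _ _) (integrable_detMoment _ _ _ _)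
      (integrable_detMoment _ _ _ _) (integrable_detMoment _ _ _ _)]
    congr 1
    ext x
    simp only [H_zero, H_two]
    ring
  rw [h, detMoment_2002, detMoment_2000, detMoment_0002, detMoment_0000]
  norm_num

lemma alphaCoef_1111 : alphaCoef 1 1 1 1 = -(3 / 8) := by
  rw [← detMoment_1111, alphaCoef, detMoment]
  congr 1
  ext x
  simp only [H_one]
  ring

/-- Explicit values of the coefficients `α_{a,b,c,d}`. -/
theorem alphaCoef_values :
    alphaCoef 0 0 0 0 = 1 ∧
    alphaCoef 2 0 0 0 = 1 / 2 ∧ alphaCoef 0 2 0 0 = 1 / 2 ∧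
    alphaCoef 0 0 2 0 = 1 / 2 ∧ alphaCoef 0 0 0 2 = 1 / 2 ∧
    alphaCoef 4 0 0 0 = -(3 / 8) ∧ alphaCoef 0 4 0 0 = -(3 / 8) ∧
    alphaCoef 0 0 4 0 = -(3 / 8) ∧ alphaCoef 0 0 0 4 = -(3 / 8) ∧
    alphaCoef 2 2 0 0 = -(1 / 8) ∧ alphaCoef 0 0 2 2 = -(1 / 8) ∧
    alphaCoef 2 0 2 0 = -(1 / 8) ∧ alphaCoef 0 2 0 2 = -(1 / 8) ∧
    alphaCoef 2 0 0 2 = 5 / 8 ∧ alphaCoef 0 2 2 0 = 5 / 8 ∧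
    alphaCoef 1 1 1 1 = -(3 / 8) := by
  have h2 := alphaCoef_2000
  have h4 := alphaCoef_4000
  have h22 := alphaCoef_2200
  have h202 := alphaCoef_2002
  refine ⟨alphaCoef_0000, h2, ?_, ?_, ?_, h4, ?_, ?_, ?_, h22, ?_, ?_, ?_, h202, ?_,
    alphaCoef_1111⟩
  · rw [alphaCoef_swap_columns 2 0 0 0, h2]
  · rw [alphaCoef_swap_rows 2 0 0 0, h2]
  · rw [alphaCoef_swap_rows 0 2 0 0, alphaCoef_swap_columns 2 0 0 0, h2]
  · rw [alphaCoef_swap_columns 4 0 0 0, h4]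
  · rw [alphaCoef_swap_rows 4 0 0 0, h4]
  · rw [alphaCoef_swap_rows 0 4 0 0, alphaCoef_swap_columns 4 0 0 0, h4]
  · rw [alphaCoef_swap_rows 2 2 0 0, h22]
  · rw [alphaCoef_transpose 2 2 0 0, h22]
  · rw [alphaCoef_swap_columns 2 0 2 0, alphaCoef_transpose 2 2 0 0, h22]
  · rw [alphaCoef_swap_columns 2 0 0 2, h202]

end
end
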